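/- Let {H_k : k = 1, …, K} be fixed d×d Hermitian matrices and {x_k : k = 1, …, K} independent centered real random variables each satisfying E[exp(θ·x_k)] ≤ exp(b²·θ²/2) for all θ ∈ ℝ, with b > 0, and set ρ = ‖Σ_k H_k²‖ > 0. Then for every θ > 0 and t ≥ 0, P( λ_max(Σ_k x_k·H_k) ≥ t ) ≤ d·exp( -θ·t + θ²·b²·ρ/2 ), and the infimum over θ > 0 of the right-hand side, attained at θ = t/(b²·ρ), equals d·exp( -t²/(2·b²·ρ) ). -/

import Mathlib

open MeasureTheory ProbabilityTheory Real Matrix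

/-- The operator (spectral) norm of a real matrix: the norm of the induced continuous
linear map between Euclidean spaces. -/
noncomputable def opNorm {m n : Type*} [Fintype m] [Fintype n] [DecidableEq n]
    (B : Matrix m n ℝ) : ℝ :=
  ‖LinearMap.toContinuousLinearMap (Matrix.toEuclideanLin B)‖

/-- The largest eigenvalue of a (Hermitian) real matrix, as the supremum of its spectrum. -/
noncomputable def lambdaMax {d : Type*} [Fintype d] [DecidableEq d]
    (A : Matrix d d ℝ) : ℝ :=
  sSup (spectrum ℝ A)

theorem gt_aux {n : Type*} [Fintype n] [DecidableEq n] (k : ℕ) :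
    (∀ M : Matrix n n ℝ, trace (M ^ 2 ^ (k+1)) ≤ trace ((M * Mᵀ) ^ 2 ^ k)) ∧
    (∀ P Q : Matrix n n ℝ, Pᵀ = P → Qᵀ = Q →
      trace ((P * Q) ^ 2 ^ k) ≤ trace (P ^ 2 ^ k * Q ^ 2 ^ k)) := by
  have sq : ∀ D : Matrix n n ℝ, 0 ≤ trace (D * Dᵀ) := by
    intro D
    simp only [trace, diag, mul_apply, transpose_apply]
    exact Finset.sum_nonneg fun i _ => Finset.sum_nonneg fun j _ => mul_self_nonneg _
  have cyc : ∀ (A B : Matrix n n ℝ) (m : ℕ), trace ((A * B) ^ m) = trace ((B * A) ^ m) := by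
    intro A B m
    cases m with
    | zero => simp
    | succ m =>
      rw [pow_succ', mul_assoc, trace_mul_comm, mul_assoc]
      have : ∀ m : ℕ, B * ((A * B) ^ m * A) = (B * A) ^ (m+1) := by
        intro m
        induction m with
        | zero => simp
        | succ m ih => rw [pow_succ' (A*B), pow_succ' (B*A), ← ih]; noncomm_ring
      rw [← this m, trace_mul_comm B, mul_assoc]
  induction k with
  | zero =>
    constructor
    · intro M
      have h := sq (M - Mᵀ)
      have e : trace ((M - Mᵀ) * (M - Mᵀ)ᵀ) = 2 * trace (M * Mᵀ) - 2 * trace (M * M) := by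
        simp only [transpose_sub, transpose_transpose, sub_mul, mul_sub, trace_sub]
        rw [trace_mul_comm Mᵀ M, ← trace_transpose (Mᵀ * Mᵀ)]
        simp only [transpose_mul, transpose_transpose]
        ring
      simp only [zero_add, pow_one, pow_zero, pow_two]
      linarith
    · intro P Q _ _; simp
  | succ k ih =>
    obtain ⟨hS, hG⟩ := ih
    constructor
    · intro M
      have h1 := hS (M ^ 2)
      have h2 := hG (Mᵀ * M) (M * Mᵀ) (by simp) (by simp)
      have h3 : trace ((M ^ 2 * (M ^ 2)ᵀ) ^ 2 ^ k) = trace ((Mᵀ * M * (M * Mᵀ)) ^ 2 ^ k) := by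
        rw [pow_two, transpose_mul, show M * M * (Mᵀ * Mᵀ) = (M * (M * Mᵀ)) * Mᵀ by noncomm_ring,
          cyc]
        simp only [mul_assoc]
      have h4 := sq ((Mᵀ * M) ^ 2 ^ k - (M * Mᵀ) ^ 2 ^ k)
      have h5 : trace ((Mᵀ * M) ^ 2 ^ (k+1)) = trace ((M * Mᵀ) ^ 2 ^ (k+1)) := cyc _ _ _
      simp only [transpose_sub, transpose_pow, transpose_mul, transpose_transpose, sub_mul,
        mul_sub, trace_sub] at h4
      rw [trace_mul_comm ((M * Mᵀ) ^ 2 ^ k) ((Mᵀ * M) ^ 2 ^ k), ← pow_add, ← pow_add,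
        show 2 ^ k + 2 ^ k = 2 ^ (k+1) by ring, h5] at h4
      rw [pow_succ' 2 (k+1), pow_mul]
      linarith
    · intro P Q hP hQ
      have h1 := hS (P * Q)
      have h2 := hG (P * P) (Q * Q) (by simp [hP]) (by simp [hQ])
      rw [transpose_mul, hP, hQ, ← mul_assoc, cyc (P * Q * Q) P,
        show P * (P * Q * Q) = P * P * (Q * Q) by noncomm_ring] at h1
      rw [pow_succ' 2 k, pow_mul P, pow_mul Q, pow_two P, pow_two Q, ← pow_succ']
      linarith

theorem pow_sub_bound {𝔸 : Type*} [NormedRing 𝔸] [NormOneClass 𝔸] (X Y : 𝔸) (M : ℝ) (hM : 1 ≤ M)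
    (hX : ‖X‖ ≤ M) (hY : ‖Y‖ ≤ M) (n : ℕ) : ‖X ^ n - Y ^ n‖ ≤ n * ‖X - Y‖ * M ^ n := by
  induction n with
  | zero => simp
  | succ n ih =>
    have e : X ^ (n+1) - Y ^ (n+1) = X ^ n * (X - Y) + (X ^ n - Y ^ n) * Y := by
      rw [pow_succ, pow_succ]; noncomm_ring
    have h1 : ‖X ^ n‖ ≤ M ^ n := (norm_pow_le X n).trans (by gcongr)
    have hM0 : 0 ≤ M := by linarith
    calc _ ≤ ‖X ^ n‖ * ‖X - Y‖ + ‖X ^ n - Y ^ n‖ * ‖Y‖ := by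
            rw [e]; exact (norm_add_le _ _).trans (add_le_add (norm_mul_le _ _) (norm_mul_le _ _))
      _ ≤ M ^ n * ‖X - Y‖ + (n * ‖X - Y‖ * M ^ n) * M := by gcongr
      _ ≤ M ^ n * M * ‖X - Y‖ + (n * ‖X - Y‖ * M ^ n) * M := by
            gcongr; exact le_mul_of_one_le_right (by positivity) hM
      _ = _ := by push_cast; ring

theorem norm_exp_le' {𝔸 : Type*} [NormedRing 𝔸] [NormOneClass 𝔸] [NormedAlgebra ℝ 𝔸] [CompleteSpace 𝔸]
    (X : 𝔸) : ‖NormedSpace.exp X‖ ≤ Real.exp ‖X‖ := by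
  rw [NormedSpace.exp_eq_tsum ℝ, Real.exp_eq_exp_ℝ, NormedSpace.exp_eq_tsum ℝ]
  refine tsum_of_norm_bounded (NormedSpace.expSeries_summable' (𝕂 := ℝ) ‖X‖).hasSum fun n => ?_
  rw [norm_smul, smul_eq_mul, Real.norm_of_nonneg (by positivity)]
  gcongr
  exact norm_pow_le X n

open Filter Topology in
theorem trotter {𝔸 : Type*} [NormedRing 𝔸] [NormOneClass 𝔸] [NormedAlgebra ℝ 𝔸] [CompleteSpace 𝔸]
    (A B : 𝔸) (hexp : ∀ X : 𝔸, ‖NormedSpace.exp X‖ ≤ Real.exp ‖X‖) (u : ℕ → ℕ) (hu : Tendsto u atTop atTop) :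
    Tendsto (fun k => (NormedSpace.exp ((u k : ℝ)⁻¹ • A) * NormedSpace.exp ((u k : ℝ)⁻¹ • B)) ^ u k)
      atTop (𝓝 (NormedSpace.exp (A + B))) := by
  have hd : HasDerivAt (fun s : ℝ => NormedSpace.exp (s • A) * NormedSpace.exp (s • B)
      - NormedSpace.exp (s • (A + B))) 0 0 := by
    have h := ((hasDerivAt_exp_smul_const (𝕂 := ℝ) A 0).mul
      (hasDerivAt_exp_smul_const (𝕂 := ℝ) B 0)).sub (hasDerivAt_exp_smul_const (𝕂 := ℝ) (A + B) 0)
    have e : NormedSpace.exp ((0:ℝ) • A) * A * NormedSpace.exp ((0:ℝ) • B) +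
        NormedSpace.exp ((0:ℝ) • A) * (NormedSpace.exp ((0:ℝ) • B) * B) -
        NormedSpace.exp ((0:ℝ) • (A + B)) * (A + B) = 0 := by
      simp [NormedSpace.exp_zero]
    rw [e] at h
    exact h
  have hs : Tendsto (fun k => (u k : ℝ)⁻¹) atTop (𝓝[≠] 0) := by
    rw [tendsto_nhdsWithin_iff]
    refine ⟨tendsto_inv_atTop_zero.comp (tendsto_natCast_atTop_atTop.comp hu), ?_⟩
    filter_upwards [hu.eventually_gt_atTop 0] with k hk
    simp; omega
  have hsl := (hasDerivAt_iff_tendsto_slope.1 hd).comp hs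
  rw [tendsto_iff_norm_sub_tendsto_zero]
  have hlim : Tendsto (fun k => ‖slope (fun s : ℝ => NormedSpace.exp (s • A) * NormedSpace.exp (s • B)
      - NormedSpace.exp (s • (A + B))) 0 ((u k : ℝ)⁻¹)‖ * Real.exp (‖A‖ + ‖B‖)) atTop (𝓝 0) := by
    have := (hsl.norm).mul_const (Real.exp (‖A‖ + ‖B‖))
    simpa using this
  refine squeeze_zero' (Eventually.of_forall fun _ => norm_nonneg _) ?_ hlim
  filter_upwards [hu.eventually_gt_atTop 0] with k hk
  have hk' : (0:ℝ) < u k := by exact_mod_cast hk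
  set s : ℝ := (u k : ℝ)⁻¹ with hsdef
  have hs0 : 0 < s := by positivity
  have hus : (u k : ℝ) * s = 1 := by rw [hsdef]; field_simp
  have e1 : NormedSpace.exp (A + B) = NormedSpace.exp (s • (A + B)) ^ u k := by
    let _ : NormedAlgebra ℚ 𝔸 := NormedAlgebra.restrictScalars ℚ ℝ 𝔸
    rw [← NormedSpace.exp_nsmul, ← Nat.cast_smul_eq_nsmul ℝ, smul_smul, hus, one_smul]
  have hXb : ‖NormedSpace.exp (s • A) * NormedSpace.exp (s • B)‖ ≤ Real.exp (s * (‖A‖ + ‖B‖)) := by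
    refine (norm_mul_le _ _).trans ?_
    rw [mul_add, Real.exp_add]
    have := hexp (s • A); have := hexp (s • B)
    simp only [norm_smul, Real.norm_eq_abs, abs_of_pos hs0] at *
    gcongr
  have hYb : ‖NormedSpace.exp (s • (A + B))‖ ≤ Real.exp (s * (‖A‖ + ‖B‖)) := by
    refine (hexp _).trans ?_
    rw [norm_smul, Real.norm_eq_abs, abs_of_pos hs0]
    gcongr; exact norm_add_le _ _
  have := pow_sub_bound _ _ _ (Real.one_le_exp (by positivity)) hXb hYb (u k)
  rw [e1]
  refine this.trans (le_of_eq ?_)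
  rw [← Real.exp_nat_mul, ← mul_assoc, hus, one_mul]
  congr 1
  simp only [slope, vsub_eq_sub, sub_zero, zero_smul, NormedSpace.exp_zero, mul_one, sub_self, norm_smul]
  rw [hsdef, inv_inv, Real.norm_eq_abs, abs_of_pos hk']

open scoped Matrix.Norms.L2Operator in
open Filter Topology in
theorem golden_thompson {d : ℕ} (A B : Matrix (Fin d) (Fin d) ℝ) (hA : Aᵀ = A) (hB : Bᵀ = B) :
    trace (NormedSpace.exp (A + B)) ≤ trace (NormedSpace.exp A * NormedSpace.exp B) := by
  rcases Nat.eq_zero_or_pos d with rfl | hd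
  · simp [trace]
  have : Nonempty (Fin d) := ⟨⟨0, hd⟩⟩
  have : NormOneClass (Matrix (Fin d) (Fin d) ℝ) := inferInstance
  have hu : Tendsto (fun k : ℕ => 2 ^ k) atTop atTop := tendsto_pow_atTop_atTop_of_one_lt one_lt_two
  have h := trotter A B norm_exp_le' _ hu
  have ht : Continuous (fun M : Matrix (Fin d) (Fin d) ℝ => trace M) := by fun_prop
  refine le_of_tendsto ((ht.tendsto _).comp h) (Eventually.of_forall fun k => ?_)
  have e : ∀ X : Matrix (Fin d) (Fin d) ℝ,
      NormedSpace.exp (((2 ^ k : ℕ) : ℝ)⁻¹ • X) ^ 2 ^ k = NormedSpace.exp X := by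
    intro X
    rw [← Matrix.exp_nsmul, ← Nat.cast_smul_eq_nsmul ℝ, smul_smul, mul_inv_cancel₀ (by positivity), one_smul]
  have := (gt_aux k).2 (NormedSpace.exp (((2 ^ k : ℕ) : ℝ)⁻¹ • A))
    (NormedSpace.exp (((2 ^ k : ℕ) : ℝ)⁻¹ • B)) (by rw [← Matrix.exp_transpose, transpose_smul, hA])
    (by rw [← Matrix.exp_transpose, transpose_smul, hB])
  rwa [e, e] at this

theorem spec {d : ℕ} (H : Matrix (Fin d) (Fin d) ℝ) (hH : H.IsHermitian) :
    ∃ (U : Matrix (Fin d) (Fin d) ℝ) (h : Fin d → ℝ), Uᵀ * U = 1 ∧ U * Uᵀ = 1 ∧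
      H = U * diagonal h * Uᵀ ∧ spectrum ℝ H = Set.range h := by
  refine ⟨hH.eigenvectorUnitary, hH.eigenvalues, ?_, ?_, ?_, hH.spectrum_real_eq_range_eigenvalues⟩
  · have := Unitary.coe_star_mul_self hH.eigenvectorUnitary
    simpa [star_eq_conjTranspose] using this
  · have := Unitary.coe_mul_star_self hH.eigenvectorUnitary
    simpa [star_eq_conjTranspose] using this
  · have := hH.spectral_theorem
    rw [Unitary.conjStarAlgAut_apply] at this
    simpa [star_eq_conjTranspose] using this

theorem exp_spec {d : ℕ} (U : Matrix (Fin d) (Fin d) ℝ) (h : Fin d → ℝ) (h1 : Uᵀ * U = 1)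
    (h2 : U * Uᵀ = 1) :
    NormedSpace.exp (U * diagonal h * Uᵀ) = U * diagonal (fun i => Real.exp (h i)) * Uᵀ := by
  have hi : U⁻¹ = Uᵀ := Matrix.inv_eq_left_inv h1
  have hu : IsUnit U := ⟨⟨U, Uᵀ, h2, h1⟩, rfl⟩
  rw [← hi, Matrix.exp_conj _ _ hu, Matrix.exp_diagonal]
  congr 3
  ext i
  rw [Pi.coe_exp, Real.exp_eq_exp_ℝ]

theorem trace_exp_spec {d : ℕ} (U : Matrix (Fin d) (Fin d) ℝ) (h : Fin d → ℝ) (h1 : Uᵀ * U = 1)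
    (h2 : U * Uᵀ = 1) :
    trace (NormedSpace.exp (U * diagonal h * Uᵀ)) = ∑ i, Real.exp (h i) := by
  rw [exp_spec U h h1 h2, trace_mul_comm, ← mul_assoc, h1, one_mul, trace_diagonal]

theorem conj_exp_nonneg {d : ℕ} (L U : Matrix (Fin d) (Fin d) ℝ) (hL : Lᵀ = L) (j : Fin d) :
    0 ≤ (Uᵀ * NormedSpace.exp L * U) j j := by
  have e : NormedSpace.exp L = NormedSpace.exp ((2:ℝ)⁻¹ • L) * (NormedSpace.exp ((2:ℝ)⁻¹ • L))ᵀ := by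
    rw [← Matrix.exp_transpose, transpose_smul, hL, ← pow_two, ← Matrix.exp_nsmul,
      ← Nat.cast_smul_eq_nsmul ℝ, smul_smul]
    norm_num
  set E := NormedSpace.exp ((2:ℝ)⁻¹ • L)
  rw [e, show Uᵀ * (E * Eᵀ) * U = (Uᵀ * E) * (Uᵀ * E)ᵀ by
    rw [transpose_mul, transpose_transpose]; noncomm_ring]
  rw [mul_apply]
  exact Finset.sum_nonneg fun i _ => mul_self_nonneg _

open scoped Matrix.Norms.L2Operator in
theorem continuous_matExp {d : ℕ} :
    Continuous (NormedSpace.exp : Matrix (Fin d) (Fin d) ℝ → Matrix (Fin d) (Fin d) ℝ) := by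
  let _ : NormedAlgebra ℚ (Matrix (Fin d) (Fin d) ℝ) := NormedAlgebra.restrictScalars ℚ ℝ _
  exact NormedSpace.exp_continuous

theorem step_bound {d : ℕ} (L U : Matrix (Fin d) (Fin d) ℝ) (h : Fin d → ℝ) (h1 : Uᵀ * U = 1)
    (h2 : U * Uᵀ = 1) (hL : Lᵀ = L) :
    trace (NormedSpace.exp (L + U * diagonal h * Uᵀ)) ≤
      ∑ j, Real.exp (h j) * (Uᵀ * NormedSpace.exp L * U) j j := by
  refine (golden_thompson L _ hL (by simp [mul_assoc])).trans (le_of_eq ?_)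
  rw [exp_spec U h h1 h2, ← mul_assoc, trace_mul_comm, ← mul_assoc, ← mul_assoc, trace_mul_comm]
  simp [trace, diagonal_mul]

theorem trace_exp_series {K d : ℕ} {Ω : Type*} [MeasurableSpace Ω]
    (μ : Measure Ω) [IsProbabilityMeasure μ]
    (H : Fin K → Matrix (Fin d) (Fin d) ℝ) (hH : ∀ k, (H k).IsHermitian)
    (x : Fin K → Ω → ℝ) (hmeas : ∀ k, Measurable (x k))
    (hindep : iIndepFun x μ) (b : ℝ)
    (hmgf : ∀ k, ∀ θ : ℝ, ∫⁻ ω, ENNReal.ofReal (Real.exp (θ * x k ω)) ∂μ ≤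
      ENNReal.ofReal (Real.exp (b ^ 2 * θ ^ 2 / 2))) (s : Finset (Fin K)) :
    ∀ L : Matrix (Fin d) (Fin d) ℝ, Lᵀ = L →
      ∫⁻ ω, ENNReal.ofReal (trace (NormedSpace.exp (L + ∑ k ∈ s, x k ω • H k))) ∂μ ≤
        ENNReal.ofReal (trace (NormedSpace.exp (L + (b ^ 2 / 2) • ∑ k ∈ s, H k ^ 2))) := by
  have hT : ∀ k, (H k)ᵀ = H k := fun k => by simpa [IsHermitian] using hH k
  induction s using Finset.induction_on with
  | empty => intro L _; simp
  | insert a s ha ih =>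
    intro L hL
    obtain ⟨U, h, h1, h2, hU, -⟩ := spec (H a) (hH a)
    set L' := L + (b ^ 2 / 2) • H a ^ 2 with hL'
    have hL'T : L'ᵀ = L' := by rw [hL', transpose_add, transpose_smul, transpose_pow, hL, hT]
    have hsq : H a ^ 2 = U * diagonal (fun j => h j ^ 2) * Uᵀ := by
      rw [hU, pow_two, show U * diagonal h * Uᵀ * (U * diagonal h * Uᵀ) =
        U * (diagonal h * (Uᵀ * U) * diagonal h) * Uᵀ by noncomm_ring, h1, mul_one,
        diagonal_mul_diagonal]
      simp only [pow_two]
    let G : (s → ℝ) → Matrix (Fin d) (Fin d) ℝ := fun y => NormedSpace.exp (L' + ∑ k, y k • H k)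
    have hGc : Continuous G := continuous_matExp.comp (by fun_prop)
    have hG : ∀ ω, NormedSpace.exp (L' + ∑ k ∈ s, x k ω • H k) = G (fun k => x k ω) := by
      intro ω
      simp only [G]
      rw [← Finset.sum_coe_sort s]
    have hsymm : ∀ ω, (L' + ∑ k ∈ s, x k ω • H k)ᵀ = L' + ∑ k ∈ s, x k ω • H k := by
      intro ω
      rw [transpose_add, transpose_sum, hL'T]
      simp only [transpose_smul, hT]
    have hpt : ∀ ω, trace (NormedSpace.exp (L + ∑ k ∈ insert a s, x k ω • H k)) ≤
        ∑ j, Real.exp (x a ω * h j - b ^ 2 / 2 * h j ^ 2) * (Uᵀ * G (fun k => x k ω) * U) j j := by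
      intro ω
      rw [← hG]
      refine le_trans (le_of_eq ?_) (step_bound _ U _ h1 h2 (hsymm ω))
      congr 2
      have e : U * diagonal (fun j => x a ω * h j - b ^ 2 / 2 * h j ^ 2) * Uᵀ =
          x a ω • H a - (b ^ 2 / 2) • H a ^ 2 := by
        rw [hsq]
        conv_rhs => rw [hU]
        rw [show diagonal (fun j => x a ω * h j - b ^ 2 / 2 * h j ^ 2) =
          x a ω • diagonal h - (b ^ 2 / 2) • diagonal (fun j => h j ^ 2) by
            rw [← diagonal_smul, ← diagonal_smul, diagonal_sub]; rfl]
        simp only [mul_sub, sub_mul, mul_smul_comm, smul_mul_assoc]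
      rw [e, Finset.sum_insert ha, hL']
      abel
    have hGn : ∀ ω j, 0 ≤ (Uᵀ * G (fun k => x k ω) * U) j j := by
      intro ω j; rw [← hG]; exact conj_exp_nonneg _ _ (hsymm ω) j
    have hGm : ∀ j, Measurable (fun y : s → ℝ => ENNReal.ofReal ((Uᵀ * G y * U) j j)) := by
      intro j
      apply Measurable.ennreal_ofReal
      apply Continuous.measurable
      have : Continuous fun y => Uᵀ * G y * U := by fun_prop
      exact this.matrix_elem j j
    have hxm : Measurable (fun ω (k : s) => x k ω) := measurable_pi_lambda _ fun k => hmeas k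
    have hem : ∀ j, Measurable (fun y : ℝ => ENNReal.ofReal (Real.exp (y * h j - b ^ 2 / 2 * h j ^ 2))) := by
      intro j; fun_prop
    have hind : IndepFun (x a) (fun ω (k : s) => x k ω) μ := by
      have := hindep.indepFun_finset {a} s (by simpa using ha) hmeas
      exact this.comp (φ := fun p : ({a} : Finset (Fin K)) → ℝ => p ⟨a, Finset.mem_singleton_self a⟩)
        (ψ := id) (measurable_pi_apply _) measurable_id
    have hone : ∀ j, ∫⁻ ω, ENNReal.ofReal (Real.exp (x a ω * h j - b ^ 2 / 2 * h j ^ 2)) ∂μ ≤ 1 := by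
      intro j
      have e : ∀ ω, ENNReal.ofReal (Real.exp (x a ω * h j - b ^ 2 / 2 * h j ^ 2)) =
          ENNReal.ofReal (Real.exp (-(b ^ 2 / 2 * h j ^ 2))) *
            ENNReal.ofReal (Real.exp (h j * x a ω)) := by
        intro ω
        rw [← ENNReal.ofReal_mul (Real.exp_nonneg _), ← Real.exp_add]
        congr 2; ring
      simp only [e]
      have hm := hmeas a
      rw [lintegral_const_mul _ (by fun_prop)]
      refine (mul_le_mul_right (hmgf a (h j)) _).trans (le_of_eq ?_)
      rw [← ENNReal.ofReal_mul (Real.exp_nonneg _), ← Real.exp_add,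
        show -(b ^ 2 / 2 * h j ^ 2) + b ^ 2 * h j ^ 2 / 2 = 0 by ring]
      simp
    calc _ ≤ ∫⁻ ω, ∑ j, ENNReal.ofReal (Real.exp (x a ω * h j - b ^ 2 / 2 * h j ^ 2)) *
            ENNReal.ofReal ((Uᵀ * G (fun k => x k ω) * U) j j) ∂μ := by
          refine lintegral_mono fun ω => ?_
          refine (ENNReal.ofReal_le_ofReal (hpt ω)).trans (le_of_eq ?_)
          rw [ENNReal.ofReal_sum_of_nonneg fun j _ => mul_nonneg (Real.exp_nonneg _) (hGn ω j)]
          exact Finset.sum_congr rfl fun j _ => ENNReal.ofReal_mul (Real.exp_nonneg _)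
      _ = ∑ j, ∫⁻ ω, ENNReal.ofReal (Real.exp (x a ω * h j - b ^ 2 / 2 * h j ^ 2)) *
            ENNReal.ofReal ((Uᵀ * G (fun k => x k ω) * U) j j) ∂μ :=
          lintegral_finsetSum _ fun j _ =>
            ((hem j).comp (hmeas a)).mul ((hGm j).comp hxm)
      _ ≤ ∑ j, ∫⁻ ω, ENNReal.ofReal ((Uᵀ * G (fun k => x k ω) * U) j j) ∂μ := by
          refine Finset.sum_le_sum fun j _ => ?_
          have := lintegral_mul_eq_lintegral_mul_lintegral_of_indepFun ((hem j).comp (hmeas a))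
            ((hGm j).comp hxm) (hind.comp (hem j) (hGm j))
          refine (le_of_eq this).trans ?_
          refine (mul_le_mul_left (hone j) _).trans (le_of_eq ?_)
          rw [one_mul]; rfl
      _ = ∫⁻ ω, ENNReal.ofReal (trace (NormedSpace.exp (L' + ∑ k ∈ s, x k ω • H k))) ∂μ := by
          refine (lintegral_finsetSum _ fun j _ => (hGm j).comp hxm).symm.trans ?_
          refine lintegral_congr fun ω => ?_
          refine (ENNReal.ofReal_sum_of_nonneg fun j _ => hGn ω j).symm.trans ?_
          rw [hG]
          congr 1
          change trace (Uᵀ * G (fun k => x k ω) * U) = _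
          rw [trace_mul_comm, ← mul_assoc, h2, one_mul]
      _ ≤ _ := ih L' hL'T
      _ = _ := by rw [Finset.sum_insert ha, hL', smul_add, add_assoc]

open scoped Matrix.Norms.L2Operator in
theorem spectrum_le_opNorm {d : ℕ} (hd : 0 < d) (S : Matrix (Fin d) (Fin d) ℝ) (r : ℝ)
    (hr : r ∈ spectrum ℝ S) : r ≤ opNorm S := by
  have : Nonempty (Fin d) := ⟨⟨0, hd⟩⟩
  have h := spectrum.norm_le_norm_of_mem hr
  have e : ‖S‖ = opNorm S := Matrix.l2_opNorm_def S
  rw [← e]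
  exact (le_abs_self r).trans h

/-- **Chernoff (Laplace transform) step in the proof of Theorem 3.3.** With `H₁, …, H_K`
fixed `d × d` Hermitian matrices, `x₁, …, x_K` independent centered random variables with
sub-Gaussian mgf parameter `b`, and `ρ = ‖Σ_k H_k²‖ > 0`: for every `θ > 0` and `t ≥ 0`,
`P(λ_max(Σ_k x_k H_k) ≥ t) ≤ d · exp(-θ t + θ² b² ρ / 2)`; the infimum over `θ > 0` of this
right-hand side equals `d · exp(-t²/(2 b² ρ))`, and (for `t > 0`) it is attained at
`θ = t/(b² ρ)`. -/
theorem matrix_subGaussian_series_chernoff_step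
    {K d : ℕ} (hd : 0 < d) {Ω : Type*} [MeasurableSpace Ω]
    (μ : Measure Ω) [IsProbabilityMeasure μ]
    (H : Fin K → Matrix (Fin d) (Fin d) ℝ) (hH : ∀ k, (H k).IsHermitian)
    (x : Fin K → Ω → ℝ) (hmeas : ∀ k, Measurable (x k))
    (hindep : iIndepFun x μ)
    (hcent : ∀ k, ∫ ω, x k ω ∂μ = 0)
    (b : ℝ) (hb : 0 < b)
    (hmgf : ∀ k, ∀ θ : ℝ, ∫⁻ ω, ENNReal.ofReal (Real.exp (θ * x k ω)) ∂μ ≤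
      ENNReal.ofReal (Real.exp (b ^ 2 * θ ^ 2 / 2)))
    (ρ : ℝ) (hρdef : ρ = opNorm (∑ k, H k ^ 2)) (hρ : 0 < ρ) :
    ∀ t ≥ 0,
      (∀ θ > 0, μ {ω | lambdaMax (∑ k, x k ω • H k) ≥ t} ≤
        ENNReal.ofReal (d * Real.exp (-θ * t + θ ^ 2 * b ^ 2 * ρ / 2))) ∧
      (⨅ θ : Set.Ioi (0 : ℝ),
        (d : ℝ) * Real.exp (-(θ : ℝ) * t + (θ : ℝ) ^ 2 * b ^ 2 * ρ / 2)) =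
          d * Real.exp (-t ^ 2 / (2 * b ^ 2 * ρ)) ∧
      (0 < t →
        (d : ℝ) * Real.exp (-(t / (b ^ 2 * ρ)) * t + (t / (b ^ 2 * ρ)) ^ 2 * b ^ 2 * ρ / 2) =
          d * Real.exp (-t ^ 2 / (2 * b ^ 2 * ρ))) := by
  intro t ht
  have hd' : (0:ℝ) < d := by exact_mod_cast hd
  have hbρ : 0 < b ^ 2 * ρ := by positivity
  have hval : (d : ℝ) * Real.exp (-(t / (b ^ 2 * ρ)) * t + (t / (b ^ 2 * ρ)) ^ 2 * b ^ 2 * ρ / 2) =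
          d * Real.exp (-t ^ 2 / (2 * b ^ 2 * ρ)) := by
    congr 2
    field_simp
    ring
  refine ⟨?_, ?_, fun _ => hval⟩
  · intro θ hθ
    have hθH : ∀ k, (θ • H k).IsHermitian := fun k => (hH k).smul (by simp [IsSelfAdjoint])
    have key := trace_exp_series μ (fun k => θ • H k) hθH x hmeas hindep b hmgf Finset.univ 0 (by simp)
    simp only [zero_add] at key
    have hS : (∑ k, H k ^ 2).IsHermitian := by
      have : ∀ k, (H k ^ 2)ᴴ = H k ^ 2 := fun k => by rw [conjTranspose_pow, hH k]
      rw [IsHermitian, conjTranspose_sum]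
      simp only [this]
    have hbd : trace (NormedSpace.exp ((b ^ 2 / 2) • ∑ k, (θ • H k) ^ 2)) ≤
        d * Real.exp (θ ^ 2 * b ^ 2 * ρ / 2) := by
      obtain ⟨U, h, h1, h2, hU, hsp⟩ := spec _ hS
      have e : (b ^ 2 / 2) • ∑ k, (θ • H k) ^ 2 =
          U * diagonal (fun i => θ ^ 2 * b ^ 2 / 2 * h i) * Uᵀ := by
        rw [show diagonal (fun i => θ ^ 2 * b ^ 2 / 2 * h i) = (θ ^ 2 * b ^ 2 / 2) • diagonal h by
          rw [← diagonal_smul]; rfl, mul_smul_comm, smul_mul_assoc, ← hU]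
        simp only [smul_pow, ← Finset.smul_sum, smul_smul]
        congr 1; ring
      rw [e, trace_exp_spec U _ h1 h2]
      calc _ ≤ ∑ i : Fin d, Real.exp (θ ^ 2 * b ^ 2 * ρ / 2) := by
            refine Finset.sum_le_sum fun i _ => ?_
            have hi : h i ≤ ρ := by
              rw [hρdef]; exact spectrum_le_opNorm hd _ _ (by rw [hsp]; exact ⟨i, rfl⟩)
            have : θ ^ 2 * b ^ 2 / 2 * h i ≤ θ ^ 2 * b ^ 2 / 2 * ρ := by gcongr
            exact Real.exp_le_exp.2 (by linarith)
        _ = _ := by simp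
    have hsub : {ω | lambdaMax (∑ k, x k ω • H k) ≥ t} ⊆
        {ω | ENNReal.ofReal (Real.exp (θ * t)) ≤
          ENNReal.ofReal (trace (NormedSpace.exp (∑ k, x k ω • θ • H k)))} := by
      intro ω hω
      simp only [Set.mem_setOf_eq] at hω ⊢
      refine ENNReal.ofReal_le_ofReal ?_
      have hA : (∑ k, x k ω • H k).IsHermitian := by
        rw [IsHermitian, conjTranspose_sum]
        exact Finset.sum_congr rfl fun k _ => by rw [conjTranspose_smul, hH k]; simp
      obtain ⟨U, h, h1, h2, hU, hsp⟩ := spec _ hA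
      have e : ∑ k, x k ω • θ • H k = U * diagonal (fun i => θ * h i) * Uᵀ := by
        rw [show diagonal (fun i => θ * h i) = θ • diagonal h by
          rw [← diagonal_smul]; rfl, mul_smul_comm, smul_mul_assoc, ← hU, Finset.smul_sum]
        exact Finset.sum_congr rfl fun k _ => smul_comm _ _ _
      have : Nonempty (Fin d) := ⟨⟨0, hd⟩⟩
      obtain ⟨i, hi⟩ : ∃ i, t ≤ h i := by
        rw [lambdaMax, hsp] at hω
        obtain ⟨i, hi⟩ := (Set.range_nonempty h).csSup_mem (Set.finite_range h)
        exact ⟨i, by rw [hi]; exact hω⟩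
      rw [e, trace_exp_spec U _ h1 h2]
      calc Real.exp (θ * t) ≤ Real.exp (θ * h i) := by gcongr
        _ ≤ _ := Finset.single_le_sum (f := fun i => Real.exp (θ * h i))
            (fun i _ => Real.exp_nonneg _) (Finset.mem_univ i)
    have hm : Measurable fun ω => ENNReal.ofReal (trace (NormedSpace.exp (∑ k, x k ω • θ • H k))) := by
      have hc : Continuous fun y : Fin K → ℝ => trace (NormedSpace.exp (∑ k, y k • θ • H k)) := by
        have : Continuous fun y : Fin K → ℝ => NormedSpace.exp (∑ k, y k • θ • H k) :=
          continuous_matExp.comp (by fun_prop)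
        exact this.matrix_trace
      exact (hc.measurable.comp (measurable_pi_lambda _ hmeas)).ennreal_ofReal
    refine (measure_mono hsub).trans ?_
    refine (meas_ge_le_lintegral_div hm.aemeasurable (by simp [Real.exp_pos]) (by simp)).trans ?_
    refine (ENNReal.div_le_div_right (key.trans (ENNReal.ofReal_le_ofReal hbd)) _).trans (le_of_eq ?_)
    rw [← ENNReal.ofReal_div_of_pos (Real.exp_pos _), mul_div_assoc, ← Real.exp_sub]
    congr 3; ring
  · apply le_antisymm
    · rw [← hval]
      set g : ℝ → ℝ := fun θ => (d : ℝ) * Real.exp (-θ * t + θ ^ 2 * b ^ 2 * ρ / 2) with hg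
      have hgc : Continuous g := by fun_prop
      set θ₀ := t / (b ^ 2 * ρ)
      have hθ₀ : 0 ≤ θ₀ := by positivity
      have hl : Filter.Tendsto g (nhdsWithin θ₀ (Set.Ioi θ₀)) (nhds (g θ₀)) :=
        (hgc.tendsto θ₀).mono_left nhdsWithin_le_nhds
      refine ge_of_tendsto hl ?_
      filter_upwards [self_mem_nhdsWithin] with θ hθ
      have hθ' : θ ∈ Set.Ioi (0:ℝ) := lt_of_le_of_lt hθ₀ hθ
      exact ciInf_le (f := fun θ : Set.Ioi (0:ℝ) => g θ)
        ⟨0, by rintro _ ⟨θ, rfl⟩; positivity⟩ ⟨θ, hθ'⟩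
    · have : Nonempty (Set.Ioi (0:ℝ)) := ⟨⟨1, by simp⟩⟩
      refine le_ciInf fun θ => ?_
      gcongr
      rw [div_le_iff₀ (by positivity)]
      nlinarith [sq_nonneg ((θ:ℝ) * (b ^ 2 * ρ) - t)]
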